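/- The function τ ↦ ĝ_τ(0) on [0,∞) is positive, strictly monotonically increasing, and tends to 1 as τ → ∞. -/

import Mathlib

open MeasureTheory Real Set FourierTransform Filter Topology

/-- The auxiliary function `g_τ`, supported on `[-1,1]`, with
`g_τ(x) = 2(1-|x|)(cos(2πτx) - cos(2π(τ+1)x))/(4π²x²)` for `0 < |x| ≤ 1` and the
continuous extension `g_τ(0) = 2τ + 1`. -/
noncomputable def gfun (τ : ℝ) (x : ℝ) : ℝ :=
  if x = 0 then 2 * τ + 1
  else if |x| ≤ 1 then
    2 * (1 - |x|) * (Real.cos (2 * π * τ * x) - Real.cos (2 * π * (τ + 1) * x)) /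
      (4 * π ^ 2 * x ^ 2)
  else 0

/-- The Fourier transform `ĝ_τ(t) = ∫_{-1}^{1} g_τ(x) e^{-2πixt} dx`.  Since `g_τ` is
real-valued, even and supported in `[-1,1]`, this equals the real-valued cosine
integral `∫ g_τ(x) cos(2πxt) dx` over `ℝ`, which we take as the definition. -/
noncomputable def ghat (τ : ℝ) (t : ℝ) : ℝ :=
  ∫ x : ℝ, gfun τ x * Real.cos (2 * π * x * t)

/-- The triangle function `x ↦ (1 - |x|)⁺`. -/
noncomputable def triangle (x : ℝ) : ℝ := max (1 - |x|) 0

/-- The cosine transform of the triangle function; it equals `sinc (π u) ^ 2`. -/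
noncomputable def triangleHat (u : ℝ) : ℝ :=
  ∫ x in (-1 : ℝ)..1, triangle x * Real.cos (2 * π * u * x)

@[fun_prop]
lemma continuous_triangle : Continuous triangle := by
  unfold triangle; fun_prop

lemma triangle_of_abs_le {x : ℝ} (h : |x| ≤ 1) : triangle x = 1 - |x| :=
  max_eq_left (by linarith)

lemma triangle_of_le_abs {x : ℝ} (h : 1 ≤ |x|) : triangle x = 0 :=
  max_eq_right (by linarith)

lemma triangle_neg (x : ℝ) : triangle (-x) = triangle x := by
  simp [triangle]

lemma support_subset_Ioc_of_triangle {E : Type*} [Zero E] {f : ℝ → E}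
    (h : ∀ x, triangle x = 0 → f x = 0) : Function.support f ⊆ Ioc (-1) 1 := by
  intro x hx
  by_contra hx'
  refine hx (h x (triangle_of_le_abs ?_))
  by_contra! hlt
  exact hx' ⟨(abs_lt.1 hlt).1, (abs_lt.1 hlt).2.le⟩

@[fun_prop]
lemma continuous_triangleHat : Continuous triangleHat := by
  unfold triangleHat
  exact intervalIntegral.continuous_parametric_intervalIntegral_of_continuous' (by fun_prop) _ _

lemma triangleHat_neg (u : ℝ) : triangleHat (-u) = triangleHat u := by
  simp [triangleHat]

lemma triangleHat_eq {u : ℝ} (hu : u ≠ 0) :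
    triangleHat u = (1 - Real.cos (2 * π * u)) / (2 * π ^ 2 * u ^ 2) := by
  have hw : 2 * π * u ≠ 0 := by positivity
  have right : ∫ x in (0 : ℝ)..1, triangle x * Real.cos (2 * π * u * x) =
      (1 - Real.cos (2 * π * u)) / (2 * π * u) ^ 2 := by
    have hd : ∀ x ∈ uIcc (0 : ℝ) 1, HasDerivAt
        (fun x => (1 - x) * (Real.sin (2 * π * u * x) / (2 * π * u)) -
          Real.cos (2 * π * u * x) / (2 * π * u) ^ 2)
        (triangle x * Real.cos (2 * π * u * x)) x := by
      intro x hx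
      rw [uIcc_of_le zero_le_one] at hx
      have hl : HasDerivAt (fun x => 2 * π * u * x) (2 * π * u) x := by
        simpa using (hasDerivAt_id x).const_mul (2 * π * u)
      refine ((((hasDerivAt_id' x).const_sub 1).fun_mul (hl.sin.div_const (2 * π * u))).fun_sub
        (hl.cos.div_const ((2 * π * u) ^ 2))).congr_deriv ?_
      rw [triangle_of_abs_le (by rw [abs_of_nonneg hx.1]; exact hx.2), abs_of_nonneg hx.1]
      field_simp
      ring
    rw [intervalIntegral.integral_eq_sub_of_hasDerivAt hd
      (Continuous.intervalIntegrable (by fun_prop) _ _)]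
    simp
    ring
  have left : ∫ x in (-1 : ℝ)..0, triangle x * Real.cos (2 * π * u * x) =
      ∫ x in (0 : ℝ)..1, triangle x * Real.cos (2 * π * u * x) := by
    simpa [triangle_neg] using (intervalIntegral.integral_comp_neg (a := (0 : ℝ)) (b := 1)
      (fun x => triangle x * Real.cos (2 * π * u * x))).symm
  rw [triangleHat, ← intervalIntegral.integral_add_adjacent_intervals (b := 0)
    (Continuous.intervalIntegrable (by fun_prop) _ _)
    (Continuous.intervalIntegrable (by fun_prop) _ _), left, right]
  field_simp
  ring

lemma triangleHat_zero : triangleHat 0 = 1 := by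
  have right : ∫ x in (0 : ℝ)..1, triangle x = 1 / 2 := by
    have : ∫ x in (0 : ℝ)..1, triangle x = ∫ x in (0 : ℝ)..1, (1 - x) := by
      refine intervalIntegral.integral_congr fun x hx => ?_
      rw [uIcc_of_le zero_le_one] at hx
      rw [triangle_of_abs_le (by rw [abs_of_nonneg hx.1]; exact hx.2), abs_of_nonneg hx.1]
    rw [this, intervalIntegral.integral_sub (by simp) (by simp)]
    norm_num
  have left : ∫ x in (-1 : ℝ)..0, triangle x = ∫ x in (0 : ℝ)..1, triangle x := by
    simpa [triangle_neg] using
      (intervalIntegral.integral_comp_neg (a := (0 : ℝ)) (b := 1) triangle).symm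
  simp only [triangleHat, mul_zero, zero_mul, Real.cos_zero, mul_one]
  rw [← intervalIntegral.integral_add_adjacent_intervals (b := 0)
    (Continuous.intervalIntegrable (by fun_prop) _ _)
    (Continuous.intervalIntegrable (by fun_prop) _ _), left, right]
  norm_num

lemma triangleHat_nonneg (u : ℝ) : 0 ≤ triangleHat u := by
  rcases eq_or_ne u 0 with rfl | hu
  · simp [triangleHat_zero]
  · rw [triangleHat_eq hu]
    have := Real.cos_le_one (2 * π * u)
    exact div_nonneg (by linarith) (by positivity)

lemma triangleHat_pos_of_irrational {u : ℝ} (hu : Irrational u) : 0 < triangleHat u := by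
  have hu0 : u ≠ 0 := hu.ne_zero
  rw [triangleHat_eq hu0]
  refine div_pos (sub_pos.2 (lt_of_le_of_ne (Real.cos_le_one _) fun h => ?_)) (by positivity)
  obtain ⟨n, hn⟩ := (Real.cos_eq_one_iff _).1 h
  refine hu.ne_int n (mul_left_cancel₀ Real.two_pi_pos.ne' ?_)
  linarith

lemma triangleHat_le (u : ℝ) : triangleHat u ≤ 2 * (1 + u ^ 2)⁻¹ := by
  rcases eq_or_ne u 0 with rfl | hu
  · simp [triangleHat_zero]
  have hu2 : 0 < u ^ 2 := by positivity
  have hpi : 9 < π ^ 2 := by nlinarith [Real.pi_gt_three]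
  rw [triangleHat_eq hu, ← div_eq_mul_inv, div_le_div_iff₀ (by positivity) (by positivity)]
  have h1 : 1 - Real.cos (2 * π * u) ≤ 2 := by linarith [Real.neg_one_le_cos (2 * π * u)]
  have h2 : 1 - Real.cos (2 * π * u) ≤ (2 * π * u) ^ 2 / 2 := by
    linarith [Real.one_sub_sq_div_two_le_cos (x := 2 * π * u)]
  nlinarith [mul_le_mul_of_nonneg_right h1 hu2.le, mul_lt_mul_of_pos_right hpi hu2]

lemma integrable_triangleHat : Integrable triangleHat := by
  refine (integrable_inv_one_add_sq.const_mul 2).mono'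
    continuous_triangleHat.aestronglyMeasurable (ae_of_all _ fun u => ?_)
  rw [Real.norm_of_nonneg (triangleHat_nonneg u)]
  exact triangleHat_le u

lemma fourier_triangle :
    𝓕 (fun x : ℝ => (triangle x : ℂ)) = fun u => (triangleHat u : ℂ) := by
  ext u
  have hodd : ∫ x in (-1 : ℝ)..1, triangle x * Real.sin (2 * π * u * x) = 0 := by
    have h := intervalIntegral.integral_comp_neg (a := (-1 : ℝ)) (b := 1)
      (fun x => triangle x * Real.sin (2 * π * u * x))
    simp only [triangle_neg, mul_neg, Real.sin_neg, neg_neg, intervalIntegral.integral_neg] at h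
    linarith
  have hexp : ∀ x : ℝ, Complex.exp (↑(-2 * π * x * u) * Complex.I) • (triangle x : ℂ) =
      ((triangle x * Real.cos (2 * π * u * x) : ℝ) : ℂ) -
        Complex.I * ((triangle x * Real.sin (2 * π * u * x) : ℝ) : ℂ) := by
    intro x
    rw [Complex.exp_mul_I, ← Complex.ofReal_cos, ← Complex.ofReal_sin,
      show -2 * π * x * u = -(2 * π * u * x) by ring, Real.cos_neg, Real.sin_neg, smul_eq_mul]
    push_cast
    ring
  rw [Real.fourier_real_eq_integral_exp_smul,
    ← intervalIntegral.integral_eq_integral_of_support_subset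
      (support_subset_Ioc_of_triangle fun x hx => by simp [hx])]
  simp only [hexp]
  rw [intervalIntegral.integral_sub (Continuous.intervalIntegrable (by fun_prop) _ _)
    (Continuous.intervalIntegrable (by fun_prop) _ _), intervalIntegral.integral_const_mul,
    intervalIntegral.integral_ofReal, intervalIntegral.integral_ofReal, hodd, triangleHat]
  simp

lemma integral_triangleHat : ∫ u, triangleHat u = 1 := by
  have hcont : Continuous fun x : ℝ => (triangle x : ℂ) := by fun_prop
  have hint : Integrable fun x : ℝ => (triangle x : ℂ) := by
    refine hcont.integrable_of_hasCompactSupport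
      (HasCompactSupport.intro (isCompact_Icc (a := (-1 : ℝ)) (b := 1)) fun x hx => ?_)
    simpa using mt (fun h => Ioc_subset_Icc_self
      (support_subset_Ioc_of_triangle (fun _ => id) h)) hx
  have h := congrFun (hcont.fourierInv_fourier_eq hint
    (by rw [fourier_triangle]; exact integrable_triangleHat.ofReal)) 0
  rw [fourier_triangle, Real.fourierInv_eq'] at h
  simp only [inner_zero_right, mul_zero, Complex.ofReal_zero, zero_mul, Complex.exp_zero,
    one_smul] at h
  rw [integral_complex_ofReal, triangle_of_abs_le (by simp)] at h
  simpa using h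

/-- The derivative in `s` of `∫ (1 - |x|)⁺ (1 - cos (2πsx)) / (2π²x²) dx`. -/
noncomputable def triangleHatPrimitive (s : ℝ) : ℝ := ∫ u in (0 : ℝ)..s, 2 * triangleHat u

@[fun_prop]
lemma continuous_triangleHatPrimitive : Continuous triangleHatPrimitive :=
  intervalIntegral.continuous_primitive
    (fun _ _ => Continuous.intervalIntegrable (by fun_prop) _ _) 0

lemma strictMono_triangleHatPrimitive : StrictMono triangleHatPrimitive := by
  intro a b hab
  rw [← sub_pos, triangleHatPrimitive, triangleHatPrimitive,
    intervalIntegral.integral_interval_sub_left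
      (Continuous.intervalIntegrable (by fun_prop) _ _)
      (Continuous.intervalIntegrable (by fun_prop) _ _)]
  obtain ⟨c, hc, hac, hcb⟩ := exists_irrational_btwn hab
  exact intervalIntegral.integral_pos hab (by fun_prop)
    (fun x _ => mul_nonneg zero_le_two (triangleHat_nonneg x))
    ⟨c, ⟨hac.le, hcb.le⟩, mul_pos two_pos (triangleHat_pos_of_irrational hc)⟩

lemma triangleHatPrimitive_zero : triangleHatPrimitive 0 = 0 := by
  simp [triangleHatPrimitive]

lemma tendsto_triangleHatPrimitive : Tendsto triangleHatPrimitive atTop (𝓝 1) := by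
  have h := intervalIntegral_tendsto_integral_Ioi 0
    (integrable_triangleHat.const_mul 2).integrableOn tendsto_id
  have habs : ∫ u, triangleHat |u| = ∫ u, triangleHat u :=
    integral_congr_ae (ae_of_all _ fun u => by
      rcases abs_choice u with hu | hu <;> simp only [hu, triangleHat_neg])
  rwa [integral_const_mul, ← integral_comp_abs, habs, integral_triangleHat] at h

lemma integral_integral_two_mul_cos {x : ℝ} (hx : x ≠ 0) (a b : ℝ) :
    ∫ s in a..b, ∫ u in (0 : ℝ)..s, 2 * Real.cos (2 * π * u * x) =
      2 * (Real.cos (2 * π * a * x) - Real.cos (2 * π * b * x)) / (4 * π ^ 2 * x ^ 2) := by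
  have hl : ∀ v, HasDerivAt (fun v => 2 * π * v * x) (2 * π * x) v := fun v => by
    simpa using ((hasDerivAt_id v).const_mul (2 * π)).mul_const x
  have inner : ∀ s : ℝ, ∫ u in (0 : ℝ)..s, 2 * Real.cos (2 * π * u * x) =
      Real.sin (2 * π * s * x) / (π * x) := by
    intro s
    rw [intervalIntegral.integral_eq_sub_of_hasDerivAt
      (f := fun u => Real.sin (2 * π * u * x) / (π * x)) (fun u _ => ?_)
      (Continuous.intervalIntegrable (by fun_prop) _ _)]
    · simp
    · refine ((hl u).sin.div_const (π * x)).congr_deriv ?_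
      field_simp
  simp only [inner]
  rw [intervalIntegral.integral_eq_sub_of_hasDerivAt
    (f := fun s => -(Real.cos (2 * π * s * x) / (2 * π ^ 2 * x ^ 2))) (fun s _ => ?_)
    (Continuous.intervalIntegrable (by fun_prop) _ _)]
  · field_simp
    ring
  · refine ((hl s).cos.div_const (2 * π ^ 2 * x ^ 2)).fun_neg.congr_deriv ?_
    field_simp

lemma gfun_eq_integral (τ x : ℝ) :
    gfun τ x = triangle x * ∫ s in τ..τ + 1, ∫ u in (0 : ℝ)..s, 2 * Real.cos (2 * π * u * x) := by
  rcases eq_or_ne x 0 with rfl | hx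
  · simp [gfun, triangle]
    ring
  · rw [integral_integral_two_mul_cos hx, gfun, if_neg hx]
    split_ifs with h
    · rw [triangle_of_abs_le h]
      ring
    · rw [triangle_of_le_abs (not_le.1 h).le, zero_mul]

lemma ghat_zero_eq_integral (τ : ℝ) :
    ghat τ 0 = ∫ s in τ..τ + 1, triangleHatPrimitive s := by
  have swap : ∀ {F : ℝ → ℝ → ℝ}, Continuous (Function.uncurry F) → ∀ a b c d : ℝ,
      ∫ x in a..b, ∫ y in c..d, F x y = ∫ y in c..d, ∫ x in a..b, F x y := by
    intro F hF a b c d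
    refine intervalIntegral_intervalIntegral_swap ?_
    exact (hF.continuousOn.integrableOn_compact (isCompact_uIcc.prod isCompact_uIcc)).mono_set
      (prod_mono uIoc_subset_uIcc uIoc_subset_uIcc)
  have hprim : Continuous (Function.uncurry fun x s : ℝ =>
      triangle x * ∫ u in (0 : ℝ)..s, 2 * Real.cos (2 * π * u * x)) := by
    refine Continuous.mul (by fun_prop) ?_
    exact intervalIntegral.continuous_parametric_intervalIntegral_of_continuous
      (f := fun (p : ℝ × ℝ) u => 2 * Real.cos (2 * π * u * p.1)) (by fun_prop) continuous_snd
  simp only [ghat, mul_zero, Real.cos_zero, mul_one]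
  rw [← intervalIntegral.integral_eq_integral_of_support_subset
    (support_subset_Ioc_of_triangle fun x hx => by rw [gfun_eq_integral, hx, zero_mul])]
  simp only [gfun_eq_integral, ← intervalIntegral.integral_const_mul] at hprim ⊢
  rw [swap hprim]
  refine intervalIntegral.integral_congr fun s _ => ?_
  rw [swap (by fun_prop), triangleHatPrimitive]
  refine intervalIntegral.integral_congr fun u _ => ?_
  simp only [triangleHat, ← intervalIntegral.integral_const_mul]
  exact intervalIntegral.integral_congr fun x _ => by ring

lemma ghat_zero_eq_integral_unit (τ : ℝ) :
    ghat τ 0 = ∫ v in (0 : ℝ)..1, triangleHatPrimitive (τ + v) := by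
  rw [ghat_zero_eq_integral, intervalIntegral.integral_comp_add_left, add_zero]

lemma triangleHatPrimitive_le_ghat_zero (τ : ℝ) : triangleHatPrimitive τ ≤ ghat τ 0 := by
  have h := intervalIntegral.integral_mono_on (μ := volume) (a := 0) (b := 1)
    (f := fun _ => triangleHatPrimitive τ) (g := fun v => triangleHatPrimitive (τ + v))
    zero_le_one (by simp) (Continuous.intervalIntegrable (by fun_prop) _ _)
    (fun v hv => strictMono_triangleHatPrimitive.monotone (by linarith [hv.1]))
  rw [ghat_zero_eq_integral_unit]
  simpa using h

lemma ghat_zero_le_triangleHatPrimitive (τ : ℝ) : ghat τ 0 ≤ triangleHatPrimitive (τ + 1) := by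
  have h := intervalIntegral.integral_mono_on (μ := volume) (a := 0) (b := 1)
    (f := fun v => triangleHatPrimitive (τ + v)) (g := fun _ => triangleHatPrimitive (τ + 1))
    zero_le_one (Continuous.intervalIntegrable (by fun_prop) _ _) (by simp)
    (fun v hv => strictMono_triangleHatPrimitive.monotone (by linarith [hv.2]))
  rw [ghat_zero_eq_integral_unit]
  simpa using h

lemma strictMono_ghat_zero : StrictMono fun τ => ghat τ 0 := by
  intro a b hab
  have hlt (v : ℝ) : triangleHatPrimitive (a + v) < triangleHatPrimitive (b + v) :=
    strictMono_triangleHatPrimitive (by linarith)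
  simp only [ghat_zero_eq_integral_unit]
  exact intervalIntegral.integral_lt_integral_of_continuousOn_of_le_of_exists_lt zero_lt_one
    (by fun_prop) (by fun_prop) (fun v _ => (hlt v).le) ⟨0, by simp, hlt 0⟩

lemma ghat_zero_pos {τ : ℝ} (hτ : 0 ≤ τ) : 0 < ghat τ 0 := by
  rw [ghat_zero_eq_integral]
  refine intervalIntegral.intervalIntegral_pos_of_pos_on
    (Continuous.intervalIntegrable (by fun_prop) _ _) (fun s hs => ?_) (by linarith)
  rw [← triangleHatPrimitive_zero]
  exact strictMono_triangleHatPrimitive (hτ.trans_lt hs.1)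

theorem ghat_at_zero_properties :
    (∀ τ : ℝ, 0 ≤ τ → 0 < ghat τ 0) ∧
    StrictMonoOn (fun τ => ghat τ 0) (Set.Ici 0) ∧
    Tendsto (fun τ => ghat τ 0) atTop (𝓝 1) := by
  refine ⟨fun τ hτ => ghat_zero_pos hτ, strictMono_ghat_zero.strictMonoOn _, ?_⟩
  exact tendsto_of_tendsto_of_tendsto_of_le_of_le tendsto_triangleHatPrimitive
    (tendsto_triangleHatPrimitive.comp (tendsto_atTop_add_const_right atTop 1 tendsto_id))
    triangleHatPrimitive_le_ghat_zero ghat_zero_le_triangleHatPrimitive
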